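/- Edge limit for class A: fix y ∈ ℝ and c ∈ ℂ, and set x_N := N + √(2N)·y + c. Then lim_{N→∞} e^{−x_N} · E_N(x_N) = (1/√π) · ∫_y^∞ e^{−t²} dt = (1/2)·erfc(y). -/

import Mathlib

open Filter Finset MeasureTheory

/-- The truncated exponential `E_n(x) = ∑_{j=0}^n x^j/j!`. -/
noncomputable def truncExp (n : ℕ) (x : ℂ) : ℂ :=
  ∑ j ∈ Finset.range (n + 1), x ^ j / (Nat.factorial j : ℂ)

/-- The complementary error function `erfc(y) = (2/√π) ∫_y^∞ e^{−t²} dt`. -/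
noncomputable def erfc (y : ℝ) : ℝ :=
  (2 / Real.sqrt Real.pi) * ∫ t in Set.Ioi y, Real.exp (-t ^ 2)

/-- The Poisson weight `e^{-x} x^n / n!`. -/
noncomputable def poissonWeight (n : ℕ) (x : ℝ) : ℝ :=
  Real.exp (-x) * (x ^ n / (Nat.factorial n : ℝ))

/-- The lower Poisson tail `e^{-x} ∑_{j=0}^n x^j / j!` at a real argument. -/
noncomputable def poissonTail (n : ℕ) (x : ℝ) : ℝ :=
  Real.exp (-x) * ∑ j ∈ Finset.range (n + 1), x ^ j / (Nat.factorial j : ℝ)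

lemma hasDerivAt_sum_pow_div_factorial {𝕜 : Type*} [RCLike 𝕜] (n : ℕ) (x : 𝕜) :
    HasDerivAt (fun x : 𝕜 => ∑ j ∈ Finset.range (n + 1), x ^ j / (Nat.factorial j : 𝕜))
      (∑ j ∈ Finset.range n, x ^ j / (Nat.factorial j : 𝕜)) x := by
  induction n with
  | zero => simpa using hasDerivAt_const x (1 : 𝕜)
  | succ n ih =>
    have h : HasDerivAt (fun x : 𝕜 => x ^ (n + 1) / (Nat.factorial (n + 1) : 𝕜))
        (x ^ n / (Nat.factorial n : 𝕜)) x := by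
      refine ((hasDerivAt_pow (n + 1) x).div_const _).congr_deriv ?_
      have h1 : (Nat.factorial n : 𝕜) ≠ 0 := Nat.cast_ne_zero.2 n.factorial_ne_zero
      have h2 : ((n : 𝕜) + 1) ≠ 0 := Nat.cast_add_one_ne_zero n
      rw [Nat.factorial_succ]
      push_cast
      field_simp
    simp_rw [Finset.sum_range_succ _ (n + 1)]
    rw [Finset.sum_range_succ]
    exact ih.add h

lemma hasDerivAt_cexp_neg_mul_truncExp (n : ℕ) (z : ℂ) :
    HasDerivAt (fun z => Complex.exp (-z) * truncExp n z)
      (-(Complex.exp (-z) * (z ^ n / (Nat.factorial n : ℂ)))) z := by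
  refine ((hasDerivAt_neg z).cexp.mul (hasDerivAt_sum_pow_div_factorial n z)).congr_deriv ?_
  rw [Finset.sum_range_succ]
  ring

lemma hasDerivAt_poissonTail (n : ℕ) (x : ℝ) :
    HasDerivAt (poissonTail n) (-poissonWeight n x) x := by
  refine ((hasDerivAt_neg x).exp.mul (hasDerivAt_sum_pow_div_factorial n x)).congr_deriv ?_
  rw [Finset.sum_range_succ, poissonWeight]
  ring

lemma tendsto_poissonTail_atTop (n : ℕ) : Tendsto (poissonTail n) atTop (nhds 0) := by
  have h : Tendsto (fun x : ℝ => ∑ j ∈ Finset.range (n + 1),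
      x ^ j * Real.exp (-x) / (Nat.factorial j : ℝ)) atTop
      (nhds (∑ j ∈ Finset.range (n + 1), 0 / (Nat.factorial j : ℝ))) :=
    tendsto_finsetSum _ fun j _ =>
      (Real.tendsto_pow_mul_exp_neg_atTop_nhds_zero j).div_const _
  simp only [zero_div, Finset.sum_const_zero] at h
  refine h.congr fun x => ?_
  rw [poissonTail, Finset.mul_sum]
  exact Finset.sum_congr rfl fun j _ => by ring

lemma cexp_neg_mul_truncExp_ofReal (n : ℕ) (x : ℝ) :
    Complex.exp (-(x : ℂ)) * truncExp n x = (poissonTail n x : ℂ) := by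
  simp [truncExp, poissonTail]

lemma natCast_add_sqrt_mul {n : ℕ} (hn : 0 < n) (u : ℝ) :
    (n : ℝ) + √(2 * n) * u = n * (1 + 2 * u / √(2 * n)) := by
  have hr : 0 < √(2 * (n : ℝ)) := Real.sqrt_pos.2 (by positivity)
  have h2 : √(2 * (n : ℝ)) ^ 2 = 2 * n := Real.sq_sqrt (by positivity)
  generalize √(2 * (n : ℝ)) = r at *
  field_simp
  linear_combination u * h2

lemma sqrt_mul_poissonWeight {n : ℕ} (hn : 0 < n) (u : ℝ) :
    √(2 * n) * poissonWeight n (n + √(2 * n) * u) =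
      (Stirling.stirlingSeq n)⁻¹ *
        ((1 + 2 * u / √(2 * n)) * Real.exp (-(2 * u / √(2 * n)))) ^ n := by
  have hf : (Nat.factorial n : ℝ) ≠ 0 := Nat.cast_ne_zero.2 n.factorial_ne_zero
  rw [natCast_add_sqrt_mul hn, poissonWeight, Stirling.stirlingSeq]
  have he : Real.exp (-((n : ℝ) * (1 + 2 * u / √(2 * n)))) =
      (Real.exp 1)⁻¹ ^ n * Real.exp (-(2 * u / √(2 * n))) ^ n := by
    rw [← Real.exp_neg, ← Real.exp_nat_mul, ← Real.exp_nat_mul, ← Real.exp_add]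
    ring_nf
  rw [he, inv_div, mul_pow, mul_pow, div_pow, inv_pow]
  ring

lemma one_add_mul_exp_neg_le {s t : ℝ} (ht : 0 ≤ t) :
    (1 + s) * Real.exp (-s) ≤ Real.exp (-((s - t) * t / (1 + t))) := by
  have h1 : (1 + s) ≤ (1 + t) * Real.exp ((s - t) / (1 + t)) := by
    have := mul_le_mul_of_nonneg_left (Real.add_one_le_exp ((s - t) / (1 + t)))
      (by positivity : 0 ≤ 1 + t)
    refine le_trans (le_of_eq ?_) this
    field_simp
    ring
  have h2 : 1 + t ≤ Real.exp t := by linarith [Real.add_one_le_exp t]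
  calc (1 + s) * Real.exp (-s)
      ≤ (Real.exp t * Real.exp ((s - t) / (1 + t))) * Real.exp (-s) := by
        gcongr
        exact h1.trans (by gcongr)
    _ = _ := by
        rw [← Real.exp_add, ← Real.exp_add]
        congr 1
        field_simp
        ring

lemma one_add_mul_exp_neg_le_one (s : ℝ) : (1 + s) * Real.exp (-s) ≤ 1 := by
  simpa using one_add_mul_exp_neg_le (s := s) le_rfl

lemma one_add_mul_exp_neg_pow_le {n : ℕ} {u : ℝ} (hn : 2 ≤ √(2 * (n : ℝ)))
    (hu : 0 ≤ 1 + 2 * u / √(2 * n)) :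
    ((1 + 2 * u / √(2 * n)) * Real.exp (-(2 * u / √(2 * n)))) ^ n ≤ Real.exp (1 - u) := by
  have h2 : √(2 * (n : ℝ)) ^ 2 = 2 * n := Real.sq_sqrt (by positivity)
  have h0 : 0 ≤ (1 + 2 * u / √(2 * n)) * Real.exp (-(2 * u / √(2 * n))) := by positivity
  rcases le_total u 1 with h | h
  · exact (pow_le_one₀ h0 (one_add_mul_exp_neg_le_one _)).trans
      (Real.one_le_exp (by linarith))
  · set r := √(2 * (n : ℝ))
    have hr : 0 < r := by linarith
    refine (pow_le_pow_left₀ h0 (one_add_mul_exp_neg_le (t := 2 / r) (by positivity)) n).trans ?_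
    rw [← Real.exp_nat_mul, Real.exp_le_exp]
    have hn' : (n : ℝ) = r ^ 2 / 2 := by linarith
    have : (n : ℝ) * -((2 * u / r - 2 / r) * (2 / r) / (1 + 2 / r)) =
        -((u - 1) * (2 * r / (r + 2))) := by
      rw [hn']
      field_simp
    rw [this]
    have h3 : 1 ≤ 2 * r / (r + 2) := by
      rw [le_div_iff₀ (by positivity)]
      linarith
    nlinarith

lemma tendsto_sqrt_two_mul_natCast : Tendsto (fun n : ℕ => √(2 * (n : ℝ))) atTop atTop :=
  Real.tendsto_sqrt_atTop.comp (tendsto_natCast_atTop_atTop.const_mul_atTop two_pos)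

lemma tendsto_div_sqrt_two_mul_natCast (a : ℝ) :
    Tendsto (fun n : ℕ => a / √(2 * (n : ℝ))) atTop (nhds 0) :=
  tendsto_sqrt_two_mul_natCast.const_div_atTop a

lemma eventually_nonneg_one_add_div_sqrt (y : ℝ) :
    ∀ᶠ n : ℕ in atTop, 0 ≤ 1 + 2 * y / √(2 * (n : ℝ)) := by
  filter_upwards [(tendsto_div_sqrt_two_mul_natCast (2 * y)).eventually
    (lt_mem_nhds (show (-1 : ℝ) < 0 by norm_num))] with n hn
  linarith

lemma tendsto_one_add_mul_exp_neg_pow (u : ℝ) :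
    Tendsto (fun n : ℕ =>
        ((1 + 2 * u / √(2 * (n : ℝ))) * Real.exp (-(2 * u / √(2 * n)))) ^ n)
      atTop (nhds (Real.exp (-u ^ 2))) := by
  have hs := tendsto_div_sqrt_two_mul_natCast (2 * u)
  have key : Tendsto (fun n : ℕ => (n : ℝ) * (Real.log (1 + 2 * u / √(2 * (n : ℝ)))
      - 2 * u / √(2 * n)) + u ^ 2) atTop (nhds 0) := by
    have hlim : Tendsto (fun n : ℕ => 2 * u ^ 2 * (|2 * u / √(2 * (n : ℝ))| /
        (1 - |2 * u / √(2 * (n : ℝ))|))) atTop (nhds 0) := by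
      have := (hs.abs.div (hs.abs.const_sub 1) (by simp)).const_mul (2 * u ^ 2)
      simpa using this
    refine squeeze_zero_norm' ?_ hlim
    filter_upwards [hs.abs.eventually (gt_mem_nhds (show |(0 : ℝ)| < 1 by simp)),
      eventually_gt_atTop 0] with n h1 hn
    have h2 : √(2 * (n : ℝ)) ^ 2 = 2 * n := Real.sq_sqrt (by positivity)
    have hr : 0 < √(2 * (n : ℝ)) := Real.sqrt_pos.2 (by positivity)
    have hlog := Real.abs_log_sub_add_sum_range_le (x := -(2 * u / √(2 * (n : ℝ))))
      (by rwa [abs_neg]) 2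
    set r := √(2 * (n : ℝ))
    have hns : (n : ℝ) * (2 * u / r) ^ 2 = 2 * u ^ 2 := by
      rw [show (n : ℝ) = r ^ 2 / 2 by linarith]
      field_simp
    set s := 2 * u / r
    rw [abs_neg, sub_neg_eq_add] at hlog
    have hexp : (n : ℝ) * (Real.log (1 + s) - s) + u ^ 2 =
        n * (∑ i ∈ Finset.range 2, (-s) ^ (i + 1) / ((i : ℝ) + 1) + Real.log (1 + s)) := by
      norm_num [Finset.sum_range_succ]
      linear_combination -(1 / 2 : ℝ) * hns
    rw [hexp, Real.norm_eq_abs, abs_mul, Nat.abs_cast]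
    refine (mul_le_mul_of_nonneg_left hlog (Nat.cast_nonneg n)).trans (le_of_eq ?_)
    rw [← hns, ← sq_abs s]
    ring
  have key' := (key.sub_const (u ^ 2)).rexp
  simp only [add_sub_cancel_right, zero_sub] at key'
  refine key'.congr' ?_
  filter_upwards [hs.eventually (lt_mem_nhds (show (-1 : ℝ) < 0 by norm_num))] with n h1
  rw [Real.exp_nat_mul, sub_eq_add_neg, Real.exp_add, Real.exp_log (by linarith)]

lemma tendsto_inv_stirlingSeq :
    Tendsto (fun n => (Stirling.stirlingSeq n)⁻¹) atTop (nhds (√Real.pi)⁻¹) :=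
  Stirling.tendsto_stirlingSeq_sqrt_pi.inv₀ (Real.sqrt_pos.2 Real.pi_pos).ne'

lemma stirlingSeq_nonneg (n : ℕ) : 0 ≤ Stirling.stirlingSeq n := by
  unfold Stirling.stirlingSeq
  positivity

lemma poissonWeight_le {n : ℕ} (hn : 0 < n) {b : ℝ} (hb : 0 ≤ b) :
    poissonWeight n b ≤ (Stirling.stirlingSeq n)⁻¹ / √(2 * n) := by
  have hr : 0 < √(2 * (n : ℝ)) := Real.sqrt_pos.2 (by positivity)
  have hn' : (0 : ℝ) < n := Nat.cast_pos.2 hn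
  obtain ⟨u, rfl⟩ : ∃ u, b = n + √(2 * n) * u := ⟨(b - n) / √(2 * n), by field_simp; ring⟩
  rw [le_div_iff₀ hr, mul_comm, sqrt_mul_poissonWeight hn]
  rw [natCast_add_sqrt_mul hn] at hb
  have hu := nonneg_of_mul_nonneg_right hb hn'
  exact mul_le_of_le_one_right (inv_nonneg.2 (stirlingSeq_nonneg n))
    (pow_le_one₀ (by positivity) (one_add_mul_exp_neg_le_one _))

lemma norm_sqrt_mul_poissonWeight_le {n : ℕ} {y u : ℝ} (hn : 2 ≤ √(2 * (n : ℝ)))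
    (hC : (Stirling.stirlingSeq n)⁻¹ ≤ 1) (hy : 0 ≤ 1 + 2 * y / √(2 * n)) (hyu : y ≤ u) :
    ‖√(2 * n) * poissonWeight n (n + √(2 * n) * u)‖ ≤ Real.exp 1 * Real.exp (-u) := by
  have hpos : 0 < n := by
    rcases Nat.eq_zero_or_pos n with rfl | h
    · norm_num at hn
    · exact h
  have hu : 0 ≤ 1 + 2 * u / √(2 * n) := hy.trans (by gcongr)
  have h0 := inv_nonneg.2 (stirlingSeq_nonneg n)
  rw [sqrt_mul_poissonWeight hpos, Real.norm_of_nonneg (by positivity), ← Real.exp_add,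
    ← sub_eq_add_neg]
  exact (mul_le_of_le_one_left (by positivity) hC).trans (one_add_mul_exp_neg_pow_le hn hu)

lemma eventually_inv_stirlingSeq_le_one : ∀ᶠ n in atTop, (Stirling.stirlingSeq n)⁻¹ ≤ 1 := by
  have h : (√Real.pi)⁻¹ < 1 :=
    inv_lt_one_of_one_lt₀ (Real.lt_sqrt_of_sq_lt (by linarith [Real.pi_gt_three]))
  exact (tendsto_inv_stirlingSeq.eventually (gt_mem_nhds h)).mono fun _ => le_of_lt

lemma continuous_sqrt_mul_poissonWeight (n : ℕ) :
    Continuous fun u : ℝ => √(2 * (n : ℝ)) * poissonWeight n (n + √(2 * n) * u) := by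
  unfold poissonWeight
  fun_prop

/-- The lower Poisson tail at the edge scaling converges to the Gaussian tail. -/
lemma tendsto_poissonTail_edge (y : ℝ) :
    Tendsto (fun n : ℕ => poissonTail n (n + √(2 * n) * y)) atTop (nhds (erfc y / 2)) := by
  have hbound : IntegrableOn (fun u : ℝ => Real.exp 1 * Real.exp (-u)) (Set.Ioi y) :=
    (integrableOn_exp_neg_Ioi y).const_mul _
  have hdom : ∀ᶠ n : ℕ in atTop, ∀ᵐ u ∂(volume.restrict (Set.Ioi y)),
      ‖√(2 * (n : ℝ)) * poissonWeight n (n + √(2 * n) * u)‖ ≤ Real.exp 1 * Real.exp (-u) := by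
    filter_upwards [tendsto_sqrt_two_mul_natCast.eventually_ge_atTop 2,
      eventually_inv_stirlingSeq_le_one, eventually_nonneg_one_add_div_sqrt y] with n h1 h2 h3
    filter_upwards [ae_restrict_mem measurableSet_Ioi] with u hu
    exact norm_sqrt_mul_poissonWeight_le h1 h2 h3 (le_of_lt hu)
  have hlim : Tendsto (fun n : ℕ => ∫ u in Set.Ioi y,
      √(2 * (n : ℝ)) * poissonWeight n (n + √(2 * n) * u)) atTop
      (nhds (∫ u in Set.Ioi y, (√Real.pi)⁻¹ * Real.exp (-u ^ 2))) := by
    refine tendsto_integral_filter_of_dominated_convergence _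
      (Eventually.of_forall fun n => (continuous_sqrt_mul_poissonWeight n).aestronglyMeasurable)
      hdom hbound (Eventually.of_forall fun u => ?_)
    refine (tendsto_inv_stirlingSeq.mul (tendsto_one_add_mul_exp_neg_pow u)).congr' ?_
    filter_upwards [eventually_gt_atTop 0] with n hn
    exact (sqrt_mul_poissonWeight hn u).symm
  have herfc : erfc y / 2 = ∫ u in Set.Ioi y, (√Real.pi)⁻¹ * Real.exp (-u ^ 2) := by
    rw [integral_const_mul, erfc]
    ring
  rw [herfc]
  refine hlim.congr' ?_
  filter_upwards [hdom, tendsto_sqrt_two_mul_natCast.eventually_gt_atTop 0] with n hd hr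
  have hderiv (u : ℝ) : HasDerivAt (fun u => -poissonTail n (n + √(2 * n) * u))
      (√(2 * (n : ℝ)) * poissonWeight n (n + √(2 * n) * u)) u := by
    have h : HasDerivAt (fun u : ℝ => (n : ℝ) + √(2 * n) * u) √(2 * (n : ℝ)) u := by
      simpa using ((hasDerivAt_id u).const_mul √(2 * (n : ℝ))).const_add (n : ℝ)
    refine ((hasDerivAt_poissonTail n _).comp u h).neg.congr_deriv ?_
    ring
  have htop : Tendsto (fun u => -poissonTail n (n + √(2 * n) * u)) atTop (nhds 0) := by
    simpa using ((tendsto_poissonTail_atTop n).comp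
      (tendsto_atTop_add_const_left _ (n : ℝ) (tendsto_id.const_mul_atTop hr))).neg
  rw [integral_Ioi_of_hasDerivAt_of_tendsto (hderiv y).continuousAt.continuousWithinAt
    (fun u _ => hderiv u)
    (hbound.mono' (continuous_sqrt_mul_poissonWeight n).aestronglyMeasurable hd) htop]
  ring

lemma norm_cexp_neg_mul_truncExp_sub_le {n : ℕ} (hn : 0 < n) {a : ℝ} (ha : 0 ≤ a) (c : ℂ) :
    ‖Complex.exp (-(a + c)) * truncExp n (a + c) - Complex.exp (-(a : ℂ)) * truncExp n a‖ ≤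
      Real.exp (2 * ‖c‖) * ((Stirling.stirlingSeq n)⁻¹ / √(2 * n)) * ‖c‖ := by
  have h := (convex_closedBall (a : ℂ) ‖c‖).norm_image_sub_le_of_norm_hasDerivWithin_le
    (C := Real.exp (2 * ‖c‖) * ((Stirling.stirlingSeq n)⁻¹ / √(2 * n)))
    (fun z _ => (hasDerivAt_cexp_neg_mul_truncExp n z).hasDerivWithinAt) ?_
    (Metric.mem_closedBall_self (norm_nonneg c)) (y := a + c) (by simp)
  · simpa using h
  · intro z hz
    rw [Metric.mem_closedBall, dist_eq_norm] at hz
    have hre : a - ‖c‖ ≤ z.re := by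
      have := (abs_le.1 ((Complex.abs_re_le_norm (z - a)).trans hz)).1
      simp only [Complex.sub_re, Complex.ofReal_re] at this
      linarith
    have hnorm : ‖z‖ ≤ a + ‖c‖ := by
      have := norm_le_norm_add_norm_sub' z (a : ℂ)
      rw [Complex.norm_of_nonneg ha] at this
      linarith
    rw [norm_neg, norm_mul, Complex.norm_exp, norm_div, norm_pow, Complex.norm_natCast,
      Complex.neg_re]
    calc Real.exp (-z.re) * (‖z‖ ^ n / (Nat.factorial n : ℝ))
        ≤ Real.exp (2 * ‖c‖ + -(a + ‖c‖)) * ((a + ‖c‖) ^ n / (Nat.factorial n : ℝ)) := by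
          gcongr
          linarith
      _ = Real.exp (2 * ‖c‖) * poissonWeight n (a + ‖c‖) := by
          rw [Real.exp_add, poissonWeight, mul_assoc]
      _ ≤ _ := by
          gcongr
          exact poissonWeight_le hn (by positivity)

/-- Edge limit for class A (complex Ginibre): with `x_N = N + √(2N) y + c`,
`e^{−x_N} E_N(x_N) → (1/2) erfc(y)`. -/
theorem statement8 (y : ℝ) (c : ℂ) :
    Tendsto (fun N : ℕ =>
        Complex.exp (-((N : ℂ) + (Real.sqrt (2 * N) : ℝ) * (y : ℂ) + c)) *
          truncExp N ((N : ℂ) + (Real.sqrt (2 * N) : ℝ) * (y : ℂ) + c))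
      atTop (nhds ((erfc y / 2 : ℝ) : ℂ)) := by
  have hreal := (Complex.continuous_ofReal.tendsto _).comp (tendsto_poissonTail_edge y)
  have hbound : Tendsto (fun N : ℕ => Real.exp (2 * ‖c‖) *
      ((Stirling.stirlingSeq N)⁻¹ / √(2 * (N : ℝ))) * ‖c‖) atTop (nhds 0) := by
    have := ((tendsto_inv_stirlingSeq.div_atTop tendsto_sqrt_two_mul_natCast).const_mul
      (Real.exp (2 * ‖c‖))).mul_const ‖c‖
    simpa using this
  have hdiff : Tendsto (fun N : ℕ =>
      Complex.exp (-((N : ℂ) + (Real.sqrt (2 * N) : ℝ) * (y : ℂ) + c)) *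
        truncExp N ((N : ℂ) + (Real.sqrt (2 * N) : ℝ) * (y : ℂ) + c) -
      (poissonTail N (N + √(2 * N) * y) : ℂ)) atTop (nhds 0) := by
    refine squeeze_zero_norm' ?_ hbound
    filter_upwards [eventually_gt_atTop 0, eventually_nonneg_one_add_div_sqrt y] with N hN hy
    have ha : 0 ≤ (N : ℝ) + √(2 * N) * y := by
      rw [natCast_add_sqrt_mul hN]
      positivity
    have h := norm_cexp_neg_mul_truncExp_sub_le hN ha c
    rw [cexp_neg_mul_truncExp_ofReal] at h
    simpa using h
  simpa using hdiff.add hreal
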